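/- Let G ~ G(n,m) for some m ∈ {0, 1, …, C(n,2)} and set p = m/C(n,2). With probability at least 1 − e^{−n}, for every partition Π of [n] one has |int(Π) ∩ E(G)| ≥ |int(Π)|·p − 2n√(np), where int(Π) is the set of unordered pairs of vertices lying in a single part of Π. -/

import Mathlib

open scoped Classical

noncomputable section

/-- The possible edges of a graph on vertex set `Fin n`. -/
abbrev EdgeType (n : ℕ) := {e : Sym2 (Fin n) // ¬ e.IsDiag}

/-- A graph on vertex set `Fin n`, identified with its edge set. -/
abbrev EdgeSetGraph (n : ℕ) := Finset (EdgeType n)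

/-- Probability of the event `A` under the uniform random graph `G(n,m)`. -/
def prGnm (n m : ℕ) (A : EdgeSetGraph n → Prop) : ℝ :=
  ((Finset.univ.filter fun G : EdgeSetGraph n => G.card = m ∧ A G).card : ℝ) /
    ((Finset.univ.filter fun G : EdgeSetGraph n => G.card = m).card : ℝ)

/-- `int(Π)` for the partition of `Fin n` given by `φ`: the unordered pairs of distinct
vertices lying in a single part. -/
def intPairs {n : ℕ} (φ : Fin n → Fin n) : Finset (EdgeType n) :=
  Finset.univ.filter fun e => (Sym2.map φ (e : Sym2 (Fin n))).IsDiag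

theorem bernoulli_mgf_le {q : ℝ} (hq0 : 0 ≤ q) (hq1 : q ≤ 1) (l : ℝ) :
    1 - q + q * Real.exp l ≤ Real.exp (q * l + l ^ 2 / 8) := by
  let μ : MeasureTheory.Measure ℝ :=
    ENNReal.ofReal (1 - q) • MeasureTheory.Measure.dirac 0 +
      ENNReal.ofReal q • MeasureTheory.Measure.dirac 1
  have : MeasureTheory.IsProbabilityMeasure μ := by
    constructor
    simp only [μ, MeasureTheory.Measure.add_apply, MeasureTheory.Measure.smul_apply,
      MeasureTheory.measure_univ, smul_eq_mul, mul_one]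
    rw [← ENNReal.ofReal_add (by linarith) hq0]
    simp
  have hint : ∀ f : ℝ → ℝ, ∫ x, f x ∂μ = (1 - q) * f 0 + q * f 1 := by
    intro f
    rw [MeasureTheory.integral_add_measure
      ((MeasureTheory.integrable_dirac (by simp)).smul_measure (by simp))
      ((MeasureTheory.integrable_dirac (by simp)).smul_measure (by simp))]
    simp [MeasureTheory.integral_smul_measure, hq0, hq1]
  have h := (ProbabilityTheory.hasSubgaussianMGF_of_mem_Icc (μ := μ) (X := id) (a := 0) (b := 1)
    aemeasurable_id (by
      rw [MeasureTheory.ae_add_measure_iff]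
      constructor <;>
      · refine MeasureTheory.Measure.ae_smul_measure ?_ _
        simp [MeasureTheory.ae_dirac_eq])).mgf_le l
  simp only [ProbabilityTheory.mgf, hint, id] at h
  norm_num at h
  rw [Real.exp_add, ← div_le_iff₀' (Real.exp_pos _), ← neg_neg (q * l), Real.exp_neg, div_inv_eq_mul]
  calc _ = (1 - q) * Real.exp (-(l * q)) + q * Real.exp (l * (1 - q)) := by
        rw [show l * (1 - q) = l + -(l * q) by ring, Real.exp_add]
        ring_nf
    _ ≤ _ := h
    _ = _ := by ring_nf

namespace Finset

theorem sum_ite_mem_one {α : Type*} [DecidableEq α] (S T : Finset α) (y : ℝ) :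
    ∑ e ∈ T, (if e ∈ S then y else 1) = (T.card : ℝ) - (S ∩ T).card * (1 - y) := by
  have : ∀ e, (if e ∈ S then y else 1) = 1 - (if e ∈ S then 1 - y else 0) := by
    intro e; split_ifs <;> ring
  simp only [this, sum_sub_distrib, sum_const, nsmul_eq_mul, mul_one, ← sum_filter]
  rw [filter_mem_eq_inter, inter_comm]
  ring

variable {α : Type*} [Fintype α] [DecidableEq α]

theorem sum_powersetCard_succ_prod {R : Type*} [CommSemiring R] (x : α → R) (m : ℕ) :
    ((m + 1 : ℕ) : R) * ∑ G ∈ powersetCard (m + 1) (univ : Finset α), ∏ e ∈ G, x e =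
      ∑ G ∈ powersetCard m (univ : Finset α), (∏ e ∈ G, x e) * ∑ e ∈ Gᶜ, x e := by
  have h : ((m + 1 : ℕ) : R) * ∑ G ∈ powersetCard (m + 1) (univ : Finset α), ∏ e ∈ G, x e =
      ∑ G ∈ powersetCard (m + 1) (univ : Finset α), ∑ _e ∈ G, ∏ e ∈ G, x e := by
    rw [mul_sum]
    refine sum_congr rfl fun G hG => ?_
    rw [sum_const, (mem_powersetCard.1 hG).2, nsmul_eq_mul]
  rw [h]
  simp only [mul_sum]
  rw [sum_sigma', sum_sigma']
  refine sum_bij' (fun a _ => ⟨a.1.erase a.2, a.2⟩) (fun a _ => ⟨insert a.2 a.1, a.2⟩) ?_ ?_ ?_ ?_ ?_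
  · rintro ⟨G, e⟩ h
    simp only [mem_sigma, mem_powersetCard_univ, mem_compl] at h ⊢
    simp [card_erase_of_mem h.2, h.1]
  · rintro ⟨G, e⟩ h
    simp only [mem_sigma, mem_powersetCard_univ, mem_compl] at h ⊢
    simp [card_insert_of_notMem h.2, h.1]
  · rintro ⟨G, e⟩ h
    simp only [mem_sigma] at h
    simp [insert_erase h.2]
  · rintro ⟨G, e⟩ h
    simp only [mem_sigma, mem_compl] at h
    simp [erase_insert h.2]
  · rintro ⟨G, e⟩ h
    simp only [mem_sigma] at h
    exact (prod_erase_mul _ _ h.2).symm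

theorem sum_powersetCard_sum_compl {R : Type*} [CommSemiring R] (x : α → R) (m : ℕ) :
    ∑ G ∈ powersetCard m (univ : Finset α), ∑ e ∈ Gᶜ, x e =
      ((Fintype.card α - 1).choose m : R) * ∑ e, x e := by
  rw [mul_sum, sum_comm' (t' := univ) (s' := fun e => powersetCard m (univ.erase e))]
  · refine sum_congr rfl fun e _ => ?_
    rw [sum_const, card_powersetCard, card_erase_of_mem (mem_univ e), card_univ, nsmul_eq_mul]
  · intro G e
    simp only [mem_powersetCard, mem_compl, mem_univ, and_true, subset_univ, true_and,
      subset_erase]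
    tauto

/-- The moment generating function of a hypergeometric variable is at most that of the binomial
variable with the same mean. -/
theorem sum_powersetCard_pow_card_inter_le (S : Finset α) {y : ℝ} (hy0 : 0 ≤ y) (hy1 : y ≤ 1)
    (m : ℕ) :
    (∑ G ∈ powersetCard m (univ : Finset α), y ^ (S ∩ G).card) * (Fintype.card α : ℝ) ^ m ≤
      ((Fintype.card α).choose m : ℝ) * ((Fintype.card α : ℝ) - S.card * (1 - y)) ^ m := by
  set N := Fintype.card α with hN
  have hX : ∑ e, (if e ∈ S then y else 1) = (N : ℝ) - S.card * (1 - y) := by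
    rw [sum_ite_mem_one, inter_univ, card_univ]
  have hprod : ∀ G : Finset α, ∏ e ∈ G, (if e ∈ S then y else 1) = y ^ (S ∩ G).card := by
    intro G
    rw [prod_ite, prod_const, prod_const_one, mul_one, filter_mem_eq_inter, inter_comm]
  have hX0 : 0 ≤ (N : ℝ) - S.card * (1 - y) := by
    rw [← hX]
    exact sum_nonneg fun e _ => by split_ifs <;> linarith
  induction m with
  | zero => simp
  | succ m ih =>
    set A := ∑ G ∈ powersetCard m (univ : Finset α), y ^ (S ∩ G).card
    set X := (N : ℝ) - S.card * (1 - y)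
    have hrec := sum_powersetCard_succ_prod (fun e => if e ∈ S then y else 1) m
    simp only [hprod] at hrec
    have hcheb : (N.choose m : ℝ) * (((m + 1 : ℕ) : ℝ) *
        ∑ G ∈ powersetCard (m + 1) (univ : Finset α), y ^ (S ∩ G).card) ≤
        A * (((N - 1).choose m : ℝ) * X) := by
      rw [hrec, ← hX, ← sum_powersetCard_sum_compl]
      have := AntivaryOn.card_mul_sum_le_sum_mul_sum (s := powersetCard m (univ : Finset α))
        (f := fun G => y ^ (S ∩ G).card) (g := fun G => ∑ e ∈ Gᶜ, (if e ∈ S then y else 1)) ?_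
      · rwa [card_powersetCard, card_univ] at this
      · intro G hG H hH hlt
        simp only [mem_coe, mem_powersetCard_univ] at hG hH
        simp only [sum_ite_mem_one, card_compl, hG, hH] at hlt
        have h1 : ((S ∩ Hᶜ).card : ℝ) * (1 - y) < (S ∩ Gᶜ).card * (1 - y) := by linarith
        have h2 : (S ∩ Hᶜ).card < (S ∩ Gᶜ).card := by
          exact_mod_cast lt_of_mul_lt_mul_right h1 (by linarith)
        have h3 : ∀ K : Finset α, (S ∩ K).card + (S ∩ Kᶜ).card = S.card := by
          intro K
          rw [← sdiff_eq_inter_compl, card_inter_add_card_sdiff]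
        exact pow_le_pow_of_le_one hy0 hy1 (by have := h3 G; have := h3 H; omega)
    have hA0 : 0 ≤ A := sum_nonneg fun G _ => by positivity
    have hc1 : (N : ℝ) * ((N - 1).choose m : ℝ) = (N.choose m : ℝ) * ((N - m : ℕ) : ℝ) := by
      rcases N.eq_zero_or_pos with h | h
      · simp [h]
      · have := Nat.choose_mul_succ_eq (N - 1) m
        rw [Nat.sub_add_cancel h] at this
        exact_mod_cast (mul_comm _ _).trans this
    have hc2 : ((m + 1 : ℕ) : ℝ) * (N.choose (m + 1) : ℝ) =
        (N.choose m : ℝ) * ((N - m : ℕ) : ℝ) := by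
      exact_mod_cast (mul_comm _ _).trans (Nat.choose_succ_right_eq N m)
    rcases lt_or_ge N (m + 1) with hNm | hNm
    · rw [powersetCard_eq_empty.2 (by rwa [card_univ]), Nat.choose_eq_zero_of_lt hNm]
      simp
    set B := ∑ G ∈ powersetCard (m + 1) (univ : Finset α), y ^ (S ∩ G).card
    have hC : (0 : ℝ) < N.choose m := by exact_mod_cast Nat.choose_pos (by omega)
    have hstep : (N : ℝ) * (((m + 1 : ℕ) : ℝ) * B) ≤ A * X * ((N - m : ℕ) : ℝ) := by
      refine le_of_mul_le_mul_left ?_ hC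
      calc (N.choose m : ℝ) * ((N : ℝ) * (((m + 1 : ℕ) : ℝ) * B))
          = N * ((N.choose m : ℝ) * (((m + 1 : ℕ) : ℝ) * B)) := by ring
        _ ≤ N * (A * (((N - 1).choose m : ℝ) * X)) := by gcongr
        _ = A * X * (N * ((N - 1).choose m : ℝ)) := by ring
        _ = _ := by rw [hc1]; ring
    refine le_of_mul_le_mul_left ?_ (show (0 : ℝ) < ((m + 1 : ℕ) : ℝ) by positivity)
    calc ((m + 1 : ℕ) : ℝ) * (B * (N : ℝ) ^ (m + 1))
        = N * (((m + 1 : ℕ) : ℝ) * B) * (N : ℝ) ^ m := by ring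
      _ ≤ A * X * ((N - m : ℕ) : ℝ) * (N : ℝ) ^ m := by gcongr
      _ = X * ((N - m : ℕ) : ℝ) * (A * (N : ℝ) ^ m) := by ring
      _ ≤ X * ((N - m : ℕ) : ℝ) * ((N.choose m : ℝ) * X ^ m) := by gcongr
      _ = ((N.choose m : ℝ) * ((N - m : ℕ) : ℝ)) * X ^ (m + 1) := by ring
      _ = _ := by rw [← hc2]; ring

/-- Hoeffding's lower tail bound for the hypergeometric distribution. -/
theorem card_filter_card_inter_lt_le (S : Finset α) {m : ℕ} (hm0 : 0 < m)
    (hm : m ≤ Fintype.card α) {t : ℝ} (ht : 0 ≤ t) :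
    (((powersetCard m (univ : Finset α)).filter fun G =>
      ((S ∩ G).card : ℝ) < S.card * ((m : ℝ) / Fintype.card α) - t).card : ℝ) ≤
      ((Fintype.card α).choose m : ℝ) * Real.exp (-(2 * t ^ 2 / m)) := by
  set N := Fintype.card α with hN
  have hm0' : (0 : ℝ) < m := by exact_mod_cast hm0
  have hN0 : (0 : ℝ) < N := by exact_mod_cast hm0.trans_le hm
  set q : ℝ := S.card / N with hq
  have hq0 : 0 ≤ q := by positivity
  have hq1 : q ≤ 1 := by
    rw [hq, div_le_one hN0]
    exact_mod_cast card_le_univ S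
  set l : ℝ := 4 * t / m with hl
  have hl0 : 0 ≤ l := by positivity
  have hmean : (S.card : ℝ) * ((m : ℝ) / N) = m * q := by rw [hq]; ring
  set y := Real.exp (-l) with hy
  have hmgf : ∑ G ∈ powersetCard m (univ : Finset α), y ^ (S ∩ G).card ≤
      (N.choose m : ℝ) * (1 - q + q * y) ^ m := by
    refine le_of_mul_le_mul_right ?_ (pow_pos hN0 m)
    refine (sum_powersetCard_pow_card_inter_le S (Real.exp_pos _).le
      (Real.exp_le_one_iff.2 (neg_nonpos.2 hl0)) m).trans_eq ?_
    rw [mul_assoc, ← mul_pow]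
    congr 2
    rw [hq]
    field_simp
    ring
  have hbern : (1 - q + q * y) ^ m ≤ Real.exp (m * (-(q * l) + l ^ 2 / 8)) := by
    rw [Real.exp_nat_mul]
    have h0 : 0 ≤ 1 - q + q * y := by
      have := mul_nonneg hq0 (Real.exp_pos (-l)).le
      linarith
    refine pow_le_pow_left₀ h0 ((bernoulli_mgf_le hq0 hq1 (-l)).trans_eq ?_) m
    ring_nf
  have hmarkov : (((powersetCard m (univ : Finset α)).filter fun G =>
      ((S ∩ G).card : ℝ) < S.card * ((m : ℝ) / N) - t).card : ℝ) * Real.exp (-l * (m * q - t)) ≤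
      ∑ G ∈ powersetCard m (univ : Finset α), y ^ (S ∩ G).card := by
    rw [← nsmul_eq_mul, ← sum_const]
    refine (sum_le_sum fun G hG => ?_).trans
      (sum_le_sum_of_subset_of_nonneg (filter_subset _ _) fun _ _ _ => by positivity)
    rw [mem_filter, hmean] at hG
    rw [hy, ← Real.exp_nat_mul]
    refine Real.exp_le_exp.2 ?_
    nlinarith [hG.2]
  refine le_of_mul_le_mul_right (hmarkov.trans (hmgf.trans ?_)) (Real.exp_pos _)
  rw [mul_assoc, ← Real.exp_add]
  refine mul_le_mul_of_nonneg_left (hbern.trans_eq ?_) (Nat.cast_nonneg _)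
  congr 1
  rw [hl]
  field_simp
  ring

end Finset

/-- The pairs of distinct vertices which receive the same colour under `c`. -/
def monoPairs {n : ℕ} {κ : Type*} (c : Fin n → κ) : Finset (EdgeType n) :=
  Finset.univ.filter fun e => (Sym2.map c (e : Sym2 (Fin n))).IsDiag

theorem intPairs_eq_monoPairs {n : ℕ} (φ : Fin n → Fin n) : intPairs φ = monoPairs φ := by
  ext e
  simp [intPairs, monoPairs]

theorem two_mul_card_filter_apply_eq {ι : Type*} [Fintype ι] {a b : ι} (hab : a ≠ b) :
    2 * (Finset.univ.filter fun s : ι → Bool => s a = s b).card = 2 ^ Fintype.card ι := by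
  have h : (Finset.univ.filter fun s : ι → Bool => s a = s b).card =
      (Finset.univ.filter fun s : ι → Bool => ¬ s a = s b).card := by
    refine Finset.card_bij' (fun s _ => Function.update s a (!s a))
      (fun s _ => Function.update s a (!s a)) ?_ ?_ ?_ ?_ <;>
    · intro s
      cases h : s a <;> cases h' : s b <;> simp [hab.symm, h, h']
  have h2 := Finset.card_filter_add_card_filter_not (s := (Finset.univ : Finset (ι → Bool)))
    (fun s => s a = s b)
  rw [← h, Finset.card_univ, Fintype.card_fun, Fintype.card_bool] at h2
  omega

theorem two_mul_card_filter_mem_monoPairs {n : ℕ} {κ : Type*} [Fintype κ] (c : Fin n → κ)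
    (e : EdgeType n) :
    (2 * (Finset.univ.filter fun s : κ → Bool => e ∈ monoPairs (s ∘ c)).card : ℝ) =
      2 ^ Fintype.card κ * (1 + if e ∈ monoPairs c then 1 else 0) := by
  obtain ⟨e, he⟩ := e
  induction e with
  | _ a b =>
    simp only [monoPairs, Finset.mem_filter, Finset.mem_univ, true_and, Sym2.map_mk,
      Sym2.mk_isDiag_iff, Function.comp]
    split_ifs with h
    · simp [h]
      ring
    · rw [add_zero, mul_one]
      exact_mod_cast two_mul_card_filter_apply_eq h

/-- Every signed weighting of total weight zero on the pairs has a two-colouring, coarsening a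
given colouring `c`, whose monochromatic pairs have at most half of the weight of those of `c`. -/
theorem exists_comp_monoPairs_sum_le {n : ℕ} {κ : Type*} [Fintype κ] (c : Fin n → κ)
    (w : EdgeType n → ℝ) (hw : ∑ e, w e = 0) :
    ∃ s : κ → Bool, 2 * ∑ e ∈ monoPairs (s ∘ c), w e ≤ ∑ e ∈ monoPairs c, w e := by
  have hsum : ∑ s : κ → Bool, 2 * ∑ e ∈ monoPairs (s ∘ c), w e =
      ∑ _s : κ → Bool, ∑ e ∈ monoPairs c, w e := by
    calc ∑ s : κ → Bool, 2 * ∑ e ∈ monoPairs (s ∘ c), w e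
        = ∑ e, ∑ s : κ → Bool, 2 * (if e ∈ monoPairs (s ∘ c) then w e else 0) := by
          rw [Finset.sum_comm]
          refine Finset.sum_congr rfl fun s _ => ?_
          rw [← Finset.mul_sum, ← Finset.sum_filter, Finset.filter_mem_eq_inter,
            Finset.univ_inter]
      _ = ∑ e, 2 ^ Fintype.card κ * (1 + if e ∈ monoPairs c then 1 else 0) * w e := by
          refine Finset.sum_congr rfl fun e _ => ?_
          rw [← two_mul_card_filter_mem_monoPairs, ← Finset.mul_sum, ← Finset.sum_filter,
            Finset.sum_const, nsmul_eq_mul, mul_assoc]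
      _ = 2 ^ Fintype.card κ * (∑ e, w e + ∑ e, if e ∈ monoPairs c then w e else 0) := by
          rw [← Finset.sum_add_distrib, Finset.mul_sum]
          refine Finset.sum_congr rfl fun e _ => ?_
          split_ifs <;> ring
      _ = _ := by
          rw [hw, zero_add, ← Finset.sum_filter, Finset.filter_mem_eq_inter, Finset.univ_inter,
            Finset.sum_const, nsmul_eq_mul, Finset.card_univ, Fintype.card_fun, Fintype.card_bool]
          push_cast
          rfl
  obtain ⟨s, -, hs⟩ := Finset.exists_le_of_sum_le Finset.univ_nonempty hsum.le
  exact ⟨s, hs⟩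

theorem two_pow_mul_exp_le (n : ℕ) :
    (2 : ℝ) ^ n * Real.exp (-(4 * n)) ≤ Real.exp (-n) := by
  have h2 : (2 : ℝ) ≤ Real.exp 3 := by linarith [Real.add_one_le_exp (3 : ℝ)]
  calc (2 : ℝ) ^ n * Real.exp (-(4 * n)) ≤ Real.exp 3 ^ n * Real.exp (-(4 * n)) := by gcongr
    _ = Real.exp (-n) := by
      rw [← Real.exp_nat_mul, ← Real.exp_add]
      ring_nf

theorem card_edgeType (n : ℕ) : Fintype.card (EdgeType n) = n.choose 2 := by
  have h := Sym2.card_subtype_not_diag (α := Fin n)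
  rw [Fintype.card_fin] at h
  rw [← h]

/-- If a graph with `m` edges has few edges inside the parts of some partition, then it has few
edges inside the parts of some partition into two parts. -/
theorem exists_bool_monoPairs_lt {n : ℕ} {κ : Type*} [Fintype κ] (c : Fin n → κ)
    {G : EdgeSetGraph n} (hN : 0 < n.choose 2) {t : ℝ}
    (h : ((monoPairs c ∩ G).card : ℝ) <
      (monoPairs c).card * ((G.card : ℝ) / n.choose 2) - 2 * t) :
    ∃ s : Fin n → Bool, ((monoPairs s ∩ G).card : ℝ) <
      (monoPairs s).card * ((G.card : ℝ) / n.choose 2) - t := by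
  set p : ℝ := (G.card : ℝ) / n.choose 2 with hp
  have hweight : ∀ S : Finset (EdgeType n),
      ∑ e ∈ S, ((if e ∈ G then 1 else 0) - p) = (S ∩ G).card - S.card * p := by
    intro S
    simp [Finset.sum_sub_distrib, Finset.sum_ite_mem]
  obtain ⟨s, hs⟩ := exists_comp_monoPairs_sum_le c (fun e => (if e ∈ G then 1 else 0) - p) (by
    have hN' : (n.choose 2 : ℝ) ≠ 0 := by exact_mod_cast hN.ne'
    rw [hweight, Finset.univ_inter, Finset.card_univ, card_edgeType, hp,
      mul_div_cancel₀ _ hN', sub_self])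
  simp only [hweight] at hs
  exact ⟨s ∘ c, by linarith⟩

theorem card_filter_card_eq {n m : ℕ} :
    (Finset.univ.filter fun G : EdgeSetGraph n => G.card = m).card = (n.choose 2).choose m := by
  rw [← card_edgeType, ← Finset.card_univ, ← Finset.card_powersetCard]
  congr 1
  ext G
  simp

theorem one_sub_prGnm_le {n m : ℕ} (hm : m ≤ n.choose 2) {A B : EdgeSetGraph n → Prop}
    (hAB : ∀ G, G.card = m → A G ∨ B G) : 1 - prGnm n m B ≤ prGnm n m A := by
  have hpos : (0 : ℝ) < (n.choose 2).choose m := by exact_mod_cast Nat.choose_pos hm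
  rw [prGnm, prGnm, card_filter_card_eq, sub_le_iff_le_add, ← add_div, one_le_div hpos,
    ← card_filter_card_eq]
  refine (Nat.cast_le.2 ((Finset.card_le_card fun G hG => ?_).trans
    (Finset.card_union_le _ _))).trans_eq (Nat.cast_add _ _)
  simp only [Finset.mem_union, Finset.mem_filter, Finset.mem_univ, true_and] at hG ⊢
  rw [← and_or_left]
  exact ⟨hG, hAB G hG⟩

theorem prGnm_exists_intPairs_lt_le {n m : ℕ} (hm0 : 0 < m) (hm : m ≤ n.choose 2) :
    prGnm n m (fun G => ∃ φ : Fin n → Fin n,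
      ((intPairs φ ∩ G).card : ℝ) < (intPairs φ).card * ((m : ℝ) / n.choose 2) -
        2 * n * Real.sqrt (n * ((m : ℝ) / n.choose 2))) ≤ Real.exp (-n) := by
  have hpos : (0 : ℝ) < (n.choose 2).choose m := by exact_mod_cast Nat.choose_pos hm
  rw [prGnm, card_filter_card_eq, div_le_iff₀' hpos]
  set N := n.choose 2 with hN
  have hN0 : 0 < N := hm0.trans_le hm
  have hN0' : (0 : ℝ) < N := by exact_mod_cast hN0
  have hm0' : (0 : ℝ) < m := by exact_mod_cast hm0
  set t : ℝ := n * Real.sqrt (n * ((m : ℝ) / N)) with ht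
  have hexp : 4 * (n : ℝ) ≤ 2 * t ^ 2 / m := by
    have h1 : t ^ 2 = n ^ 2 * (n * (m / N)) := by
      rw [ht, mul_pow, Real.sq_sqrt (by positivity)]
    have h2 : (N : ℝ) ≤ n ^ 2 / 2 := by
      rw [hN, Nat.cast_choose_two]
      nlinarith [Nat.cast_nonneg (α := ℝ) n]
    rw [h1, show 2 * ((n : ℝ) ^ 2 * (n * (m / N))) / m = 2 * n ^ 2 * n / N by field_simp,
      le_div_iff₀ hN0']
    nlinarith [mul_le_mul_of_nonneg_left h2 (Nat.cast_nonneg (α := ℝ) n)]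
  let bad : (Fin n → Bool) → Finset (EdgeSetGraph n) := fun s =>
    (Finset.powersetCard m Finset.univ).filter fun G =>
      ((monoPairs s ∩ G).card : ℝ) < (monoPairs s).card * ((m : ℝ) / N) - t
  have hbad : ∀ s, ((bad s).card : ℝ) ≤ N.choose m * Real.exp (-(4 * n)) := by
    intro s
    have h := Finset.card_filter_card_inter_lt_le (monoPairs s) hm0
      (by rwa [card_edgeType]) (t := t) (by positivity)
    rw [card_edgeType] at h
    refine h.trans ?_
    gcongr
  calc _ ≤ ((Finset.univ.biUnion bad).card : ℝ) := by
        refine Nat.cast_le.2 (Finset.card_le_card fun G hG => ?_)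
        simp only [Finset.mem_filter, Finset.mem_univ, true_and] at hG
        obtain ⟨hGm, φ, hφ⟩ := hG
        rw [intPairs_eq_monoPairs, mul_assoc 2, ← ht, ← hGm] at hφ
        obtain ⟨s, hs⟩ := exists_bool_monoPairs_lt φ hN0 hφ
        rw [hGm] at hs
        exact Finset.mem_biUnion.2 ⟨s, Finset.mem_univ s,
          Finset.mem_filter.2 ⟨Finset.mem_powersetCard_univ.2 hGm, hs⟩⟩
    _ ≤ ∑ s, ((bad s).card : ℝ) := by exact_mod_cast Finset.card_biUnion_le
    _ ≤ ∑ _s : Fin n → Bool, N.choose m * Real.exp (-(4 * n)) :=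
        Finset.sum_le_sum fun s _ => hbad s
    _ = N.choose m * (2 ^ n * Real.exp (-(4 * n))) := by
        simp only [Finset.sum_const, Finset.card_univ, Fintype.card_fun, Fintype.card_bool,
          Fintype.card_fin, nsmul_eq_mul]
        push_cast
        ring
    _ ≤ _ := by
        gcongr
        exact two_pow_mul_exp_le n

/-- For `G ~ G(n,m)` and `p = m/C(n,2)`: with probability at least `1 - e^{-n}`, every
partition `Π` of `[n]` satisfies `|int(Π) ∩ G| ≥ |int(Π)| p - 2n√(np)`. -/
theorem whp_int_edges_lower
    (n m : ℕ) (hm : m ≤ n.choose 2) :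
    1 - Real.exp (-(n : ℝ)) ≤
      prGnm n m (fun G => ∀ φ : Fin n → Fin n,
        ((intPairs φ).card : ℝ) * ((m : ℝ) / (n.choose 2 : ℝ)) -
            2 * n * Real.sqrt ((n : ℝ) * ((m : ℝ) / (n.choose 2 : ℝ))) ≤
          (((intPairs φ) ∩ G).card : ℝ)) := by
  rcases m.eq_zero_or_pos with rfl | hm0
  · refine le_trans ?_ (one_sub_prGnm_le (B := fun _ => False) hm fun G _ => Or.inl (by simp))
    simp [prGnm, Real.exp_nonneg]
  · refine le_trans (sub_le_sub_left (prGnm_exists_intPairs_lt_le hm0 hm) 1)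
      (one_sub_prGnm_le hm fun G _ => ?_)
    by_contra! h
    obtain ⟨⟨φ, hφ⟩, h⟩ := h
    exact (h φ).not_gt hφ

end
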